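/- Let [x_k] be a nonsingular Gaussian sequence with positive definite joint covariance matrix C. Then [x_k] is CM_L if and only if C⁻¹ has the CM_L form, i.e., the d×d blocks of C⁻¹ satisfy (C⁻¹)_{i,j} = 0 for all i, j ∈ [0,N] with |i − j| ≥ 2 and N ∉ {i, j}. -/

import Mathlib

open MeasureTheory ProbabilityTheory

variable {Ω : Type*}

/-- The σ-field generated by the random variables `x k`, `k ∈ S`. -/
noncomputable def sigmaOf [MeasurableSpace Ω] {d : ℕ} (x : ℕ → Ω → (Fin d → ℝ)) (S : Set ℕ) :
    MeasurableSpace Ω :=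
  ⨆ k ∈ S, MeasurableSpace.comap (x k) inferInstance

lemma sigmaOf_le [m : MeasurableSpace Ω] {d : ℕ} {x : ℕ → Ω → (Fin d → ℝ)}
    (hx : ∀ k, Measurable (x k)) (S : Set ℕ) : sigmaOf x S ≤ m :=
  iSup_le fun k => iSup_le fun _ => (hx k).comap_le

/-- `[x_k]` is `CM_c` over `[0,N]` (`CM_F` for `c = 0`, `CM_L` for `c = N`): for every
`j ∈ [0,N]`, the σ-fields generated by `{x_k : k ∈ [j+1,N]} \ {x_c}` and by
`{x_k : k ∈ [0,j-1]} \ {x_c}` are conditionally independent given `σ(x_j, x_c)`. -/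
def IsCM [MeasurableSpace Ω] [StandardBorelSpace Ω] {d : ℕ} (N c : ℕ)
    (P : Measure Ω) [IsFiniteMeasure P]
    (x : ℕ → Ω → (Fin d → ℝ)) (hx : ∀ k, Measurable (x k)) : Prop :=
  ∀ j ≤ N, CondIndep (sigmaOf x {j, c})
    (sigmaOf x {k | j < k ∧ k ≤ N ∧ k ≠ c})
    (sigmaOf x {k | k < j ∧ k ≠ c})
    (sigmaOf_le hx _) P

/-- A random vector is (jointly) Gaussian iff every linear functional of it has a
(possibly degenerate) one-dimensional Gaussian distribution (Cramér–Wold). -/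
def IsGaussianVec {ι : Type*} [Fintype ι] [MeasurableSpace Ω]
    (X : Ω → (ι → ℝ)) (P : Measure Ω) : Prop :=
  ∀ a : ι → ℝ, ∃ (mu : ℝ) (v : NNReal),
    Measure.map (fun ω => ∑ i, a i * X ω i) P = gaussianReal mu v

/-- The stacked vector `(x_0', …, x_N')' ∈ ℝ^{(N+1)d}` of the sequence. -/
def stacked {d : ℕ} (N : ℕ) [MeasurableSpace Ω] (x : ℕ → Ω → (Fin d → ℝ)) (ω : Ω) :
    Fin (N + 1) × Fin d → ℝ :=
  fun p => x p.1 ω p.2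

open Matrix

/-- The σ-field generated by the real random variables `X p`, `p ∈ A`. -/
abbrev coordSigma {I : Type*} (X : I → Ω → ℝ) (A : Set I) : MeasurableSpace Ω :=
  ⨆ p ∈ A, MeasurableSpace.comap (X p) inferInstance

section coordSigma

variable {I : Type*} {X : I → Ω → ℝ} {A B : Set I}

lemma coordSigma_le [m : MeasurableSpace Ω] (hX : ∀ p, Measurable (X p)) (A : Set I) :
    coordSigma X A ≤ m :=
  iSup₂_le fun p _ => (hX p).comap_le

lemma measurable_coordSigma {p : I} (hp : p ∈ A) : Measurable[coordSigma X A] (X p) :=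
  measurable_iff_comap_le.2 (le_iSup₂_of_le p hp le_rfl)

lemma coordSigma_le_iff {m : MeasurableSpace Ω} :
    coordSigma X A ≤ m ↔ ∀ p ∈ A, Measurable[m] (X p) := by
  simp only [coordSigma, iSup_le_iff, measurable_iff_comap_le]

lemma coordSigma_mono (h : A ⊆ B) : coordSigma X A ≤ coordSigma X B :=
  coordSigma_le_iff.2 fun _ hp => measurable_coordSigma (h hp)

lemma coordSigma_eq_comap (X : I → Ω → ℝ) (A : Set I) :
    coordSigma X A = MeasurableSpace.comap (fun ω (a : A) => X a ω) MeasurableSpace.pi := by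
  simp only [coordSigma, MeasurableSpace.pi, MeasurableSpace.comap_iSup,
    MeasurableSpace.comap_comp, iSup_subtype]
  rfl

end coordSigma

section CondIndep

variable {m m₁ m₂ : MeasurableSpace Ω} [mΩ : MeasurableSpace Ω] [StandardBorelSpace Ω]
  {P : Measure Ω}

lemma condIndep_iff_indep_of_indep [IsProbabilityMeasure P] (hm : m ≤ mΩ) (h₁ : m₁ ≤ mΩ)
    (h₂ : m₂ ≤ mΩ) (h : Indep (m₁ ⊔ m₂) m P) : CondIndep m m₁ m₂ hm P ↔ Indep m₁ m₂ P := by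
  have key : ∀ t, MeasurableSet[m₁ ⊔ m₂] t → P⟦t | m⟧ =ᵐ[P] fun _ => P.real t := by
    intro t ht
    have := condExp_indep_eq (sup_le h₁ h₂) hm
      ((stronglyMeasurable_const (b := (1 : ℝ))).indicator ht) h
    simpa [integral_indicator (sup_le h₁ h₂ t ht)] using this
  rw [condIndep_iff _ _ _ hm h₁ h₂, Indep_iff]
  refine forall₂_congr fun t₁ t₂ => forall₂_congr fun ht₁ ht₂ => ?_
  have ht₁' : MeasurableSet[m₁ ⊔ m₂] t₁ := (le_sup_left : m₁ ≤ m₁ ⊔ m₂) _ ht₁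
  have ht₂' : MeasurableSet[m₁ ⊔ m₂] t₂ := (le_sup_right : m₂ ≤ m₁ ⊔ m₂) _ ht₂
  have e := key _ (MeasurableSet.inter ht₁' ht₂')
  have e' := (key _ ht₁').mul (key _ ht₂')
  have : P (t₁ ∩ t₂) = P t₁ * P t₂ ↔ P.real (t₁ ∩ t₂) = P.real t₁ * P.real t₂ := by
    simp only [Measure.real, ← ENNReal.toReal_mul]
    rw [ENNReal.toReal_eq_toReal_iff' (by finiteness) (by finiteness)]
  rw [this]
  constructor
  · intro h
    obtain ⟨ω, hω⟩ := (e.symm.trans (h.trans e')).exists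
    exact hω
  · intro h
    refine e.trans (Filter.EventuallyEq.trans ?_ e'.symm)
    exact Filter.Eventually.of_forall fun _ => h

lemma CondIndep.sup_left [IsFiniteMeasure P] (hm : m ≤ mΩ) (h₁ : m₁ ≤ mΩ)
    (h₂ : m₂ ≤ mΩ) (h : CondIndep m m₁ m₂ hm P) : CondIndep m (m₁ ⊔ m) m₂ hm P := by
  let p : Set (Set Ω) := {u | ∃ s t, MeasurableSet[m₁] s ∧ MeasurableSet[m] t ∧ u = s ∩ t}
  have hp : IsPiSystem p := by
    rintro _ ⟨s, t, hs, ht, rfl⟩ _ ⟨s', t', hs', ht', rfl⟩ -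
    exact ⟨s ∩ s', t ∩ t', hs.inter hs', ht.inter ht', Set.inter_inter_inter_comm ..⟩
  have hgen : m₁ ⊔ m = MeasurableSpace.generateFrom p := by
    refine le_antisymm (sup_le ?_ ?_) (MeasurableSpace.generateFrom_le ?_)
    · exact fun s hs => MeasurableSpace.measurableSet_generateFrom
        ⟨s, Set.univ, hs, MeasurableSet.univ, by simp⟩
    · exact fun t ht => MeasurableSpace.measurableSet_generateFrom
        ⟨Set.univ, t, MeasurableSet.univ, ht, by simp⟩
    · rintro _ ⟨s, t, hs, ht, rfl⟩
      exact MeasurableSet.inter ((le_sup_left : m₁ ≤ m₁ ⊔ m) _ hs)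
        ((le_sup_right : m ≤ m₁ ⊔ m) _ ht)
  rw [condIndep_iff _ _ _ hm h₁ h₂] at h
  refine CondIndepSets.condIndep (sup_le h₁ hm) h₂ hp (@MeasurableSpace.isPiSystem_measurableSet _ m₂)
    hgen (@MeasurableSpace.generateFrom_measurableSet _ m₂).symm ?_
  refine (condIndepSets_iff _ _ _ {s | MeasurableSet[m₂] s} ?_ (fun s hs => h₂ s hs) P).2 ?_
  rotate_left
  · rintro _ u ⟨s, t, hs, ht, rfl⟩ hu
    have ind : ∀ v, MeasurableSet v → P⟦v ∩ t | m⟧ =ᵐ[P] t.indicator (P⟦v | m⟧) := by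
      intro v hv
      have := condExp_indicator (m := m) (μ := P)
        ((integrable_const (1 : ℝ)).indicator hv) ht
      rwa [Set.indicator_indicator, Set.inter_comm] at this
    have e₁ := ind (s ∩ u) ((h₁ _ hs).inter (h₂ _ hu))
    have e₂ := ind s (h₁ _ hs)
    rw [Set.inter_right_comm]
    filter_upwards [e₁, e₂, h s u hs hu] with ω h1 h2 h3
    rw [h1, Pi.mul_apply, h2]
    by_cases hω : ω ∈ t <;> simp [hω, h3]
  · rintro _ ⟨s, t, hs, ht, rfl⟩
    exact (h₁ _ hs).inter (hm _ ht)

lemma CondIndep.sup_sup [IsFiniteMeasure P] (hm : m ≤ mΩ) (h₁ : m₁ ≤ mΩ)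
    (h₂ : m₂ ≤ mΩ) (h : CondIndep m m₁ m₂ hm P) : CondIndep m (m₁ ⊔ m) (m₂ ⊔ m) hm P :=
  (CondIndep.sup_left hm h₂ (sup_le h₁ hm) (CondIndep.sup_left hm h₁ h₂ h).symm).symm

end CondIndep

section Matrix

variable {I : Type*} [Fintype I] [DecidableEq I]

lemma Matrix.inv_apply_eq_zero_of_forall {M : Matrix I I ℝ} (hM : IsUnit M) {A : Set I}
    (h : ∀ a ∈ A, ∀ b ∉ A, M a b = 0) : ∀ a ∈ A, ∀ b ∉ A, M⁻¹ a b = 0 := by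
  classical
  have := hM.invertible
  have hb : M.BlockTriangular (fun i => if i ∈ A then (1 : ℕ) else 0) := by
    intro i j hij
    by_cases hi : i ∈ A <;> by_cases hj : j ∈ A <;> simp_all
  intro a ha b hb'
  exact blockTriangular_inv_of_blockTriangular hb (by simp [ha, hb'])

/-- Coefficients of the residuals of the best linear prediction from the coordinates in `S`. -/
lemma Matrix.PosDef.exists_residual_matrix {C : Matrix I I ℝ} (hC : C.PosDef) (S : Set I)
    [DecidablePred (· ∈ S)] :
    ∃ W : Matrix {p // p ∉ S} I ℝ, (∀ t u : {p // p ∉ S}, t ≠ u → W t u = 0) ∧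
      (∀ t : {p // p ∉ S}, W t t = 1) ∧
      (∀ t, ∀ q ∈ S, (W * C) t q = 0) ∧
      W * C * Wᵀ = (C⁻¹.submatrix Subtype.val Subtype.val)⁻¹ := by
  let v : {p // p ∉ S} → I := Subtype.val
  have hQ : (C⁻¹.submatrix v v).PosDef :=
    hC.inv.submatrix Subtype.val_injective
  set K := (C⁻¹.submatrix v v)⁻¹ with hK
  let W : Matrix {p // p ∉ S} I ℝ := K * C⁻¹.submatrix v id
  have hW : W.submatrix id v = 1 := by
    have : W.submatrix id v = K * C⁻¹.submatrix v v := rfl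
    rw [this, hK, Matrix.nonsing_inv_mul _ ((Matrix.isUnit_iff_isUnit_det _).1 hQ.isUnit)]
  have hWC : W * C = K * (1 : Matrix I I ℝ).submatrix v id := by
    have : C⁻¹.submatrix v id * C =
        (C⁻¹ * C).submatrix v id := rfl
    rw [Matrix.mul_assoc, this,
      Matrix.nonsing_inv_mul _ ((Matrix.isUnit_iff_isUnit_det _).1 hC.isUnit)]
  have happ : ∀ t u : {p // p ∉ S}, W t u = (1 : Matrix _ _ ℝ) t u := fun t u => by
    rw [← hW]; rfl
  refine ⟨W, fun t u htu => by rw [happ, Matrix.one_apply_ne htu],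
    fun t => by rw [happ, Matrix.one_apply_eq], fun t q hq => ?_, ?_⟩
  · rw [hWC, Matrix.mul_apply]
    refine Finset.sum_eq_zero fun r _ => ?_
    have : v r ≠ q := by
      rintro rfl
      exact r.2 hq
    exact mul_eq_zero_of_right _ (Matrix.one_apply_ne this)
  · have : (1 : Matrix I I ℝ).submatrix v id * Wᵀ =
        (W.submatrix id v)ᵀ := by
      ext r t
      simp [Matrix.mul_apply, Matrix.one_apply]
    rw [hWC, Matrix.mul_assoc, this, hW, Matrix.transpose_one, Matrix.mul_one]

end Matrix

section Gaussian

variable [MeasurableSpace Ω] {P : Measure Ω} {I κ ι : Type*} [Fintype I]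
  {X : I → Ω → ℝ} {C : Matrix I I ℝ}

lemma covariance_mulVec [IsFiniteMeasure P] (hX : ∀ p, MemLp (X p) 2 P) (hC : ∀ p q, C p q = cov[X p, X q; P])
    (U : Matrix κ I ℝ) (V : Matrix ι I ℝ) (k : κ) (l : ι) :
    cov[fun ω => (U *ᵥ fun p => X p ω) k, fun ω => (V *ᵥ fun p => X p ω) l; P] =
      (U * C * Vᵀ) k l := by
  simp only [mulVec, dotProduct]
  rw [covariance_fun_sum_fun_sum (fun i => (hX i).const_mul _) (fun i => (hX i).const_mul _)]
  simp only [covariance_const_mul_left, covariance_const_mul_right, ← hC, Matrix.mul_apply,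
    Matrix.transpose_apply, Finset.sum_mul]
  rw [Finset.sum_comm]
  exact Finset.sum_congr rfl fun i _ => Finset.sum_congr rfl fun j _ => by ring

lemma indepFun_mulVec [Fintype κ] [Fintype ι] (hG : HasGaussianLaw (fun ω p => X p ω) P)
    (hC : ∀ p q, C p q = cov[X p, X q; P]) {U : Matrix κ I ℝ} {V : Matrix ι I ℝ}
    (h : U * C * Vᵀ = 0) :
    IndepFun (fun ω => U *ᵥ fun p => X p ω) (fun ω => V *ᵥ fun p => X p ω) P := by
  refine HasGaussianLaw.indepFun_of_covariance_eval
    (X := fun k ω => (U *ᵥ fun p => X p ω) k) (Y := fun l ω => (V *ᵥ fun p => X p ω) l)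
    ?_ fun k l => ?_
  · exact hG.map_fun
      ((LinearMap.toContinuousLinearMap U.mulVecLin).prod
        (LinearMap.toContinuousLinearMap V.mulVecLin))
  · have := hG.isProbabilityMeasure
    rw [covariance_mulVec (fun p => (hG.eval p).memLp_two) hC, h, Matrix.zero_apply]


/-- For a nonsingular Gaussian vector whose coordinates are partitioned into `A`, `B` and `S`,
the coordinates in `A` and `B` are conditionally independent given those in `S` iff the
`(A, B)` block of the precision matrix vanishes. -/
lemma condIndep_coordSigma_iff [DecidableEq I] [StandardBorelSpace Ω] [IsProbabilityMeasure P]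
    (hX : ∀ p, Measurable (X p)) (hG : HasGaussianLaw (fun ω p => X p ω) P)
    (hC : ∀ p q, C p q = cov[X p, X q; P]) (hCpd : C.PosDef) {A B S : Set I}
    (hcover : ∀ p, p ∈ A ∨ p ∈ B ∨ p ∈ S) (hAB : Disjoint A B) (hAS : Disjoint A S)
    (hBS : Disjoint B S) :
    CondIndep (coordSigma X S) (coordSigma X A) (coordSigma X B) (coordSigma_le hX S) P ↔
      ∀ a ∈ A, ∀ b ∈ B, C⁻¹ a b = 0 := by
  classical
  obtain ⟨W, hW0, hW1, hWC, hWCW⟩ := hCpd.exists_residual_matrix S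
  let v : {p // p ∉ S} → I := Subtype.val
  let R : {p // p ∉ S} → Ω → ℝ := fun t ω => (W *ᵥ fun p => X p ω) t
  have hLp : ∀ p, MemLp (X p) 2 P := fun p => (hG.eval p).memLp_two
  have hR : ∀ t, Measurable (R t) := fun t =>
    Finset.measurable_sum _ fun q _ => (hX q).const_mul _
  have hRLp : ∀ t, MemLp (R t) 2 P := fun t =>
    memLp_finsetSum _ fun q _ => (hLp q).const_mul _
  have hcov : ∀ t u, cov[R t, R u; P] = (C⁻¹.submatrix v v)⁻¹ t u := fun t u => by
    rw [← hWCW]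
    exact covariance_mulVec hLp hC W W t u
  have hsum : ∀ (t : {p // p ∉ S}) (m : MeasurableSpace Ω), coordSigma X S ≤ m →
      Measurable[m] fun ω => R t ω - X t ω := by
    intro t m hm
    have : (fun ω => R t ω - X t ω) = fun ω => ∑ q ∈ Finset.univ.erase (t : I), W t q * X q ω := by
      ext ω
      simp only [R, mulVec, dotProduct]
      rw [← Finset.add_sum_erase _ _ (Finset.mem_univ (t : I)), hW1]
      ring
    rw [this]
    refine Finset.measurable_sum _ fun q hq => ?_
    by_cases hqS : q ∈ S
    · exact ((measurable_coordSigma hqS).mono hm le_rfl).const_mul _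
    · have : W t q = 0 := hW0 t ⟨q, hqS⟩ fun h => Finset.ne_of_mem_erase hq (by rw [h])
      simp only [this, zero_mul]
      exact measurable_const
  have hRX : ∀ D : Set I, coordSigma R (v ⁻¹' D) ≤ coordSigma X D ⊔ coordSigma X S := by
    refine fun D => coordSigma_le_iff.2 fun t ht => ?_
    have h := (hsum t _ (le_sup_right : _ ≤ coordSigma X D ⊔ coordSigma X S)).add
      ((measurable_coordSigma (X := X) ht).mono le_sup_left le_rfl)
    convert h using 1
    ext ω
    exact (sub_add_cancel _ _).symm
  have hXR : ∀ D : Set I, Disjoint D S →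
      coordSigma X D ≤ coordSigma R (v ⁻¹' D) ⊔ coordSigma X S := by
    refine fun D hD => coordSigma_le_iff.2 fun p hp => ?_
    let t : {p // p ∉ S} := ⟨p, hD.notMem_of_mem_left hp⟩
    have h := ((measurable_coordSigma (X := R) (A := v ⁻¹' D) (p := t) hp).mono
      (le_sup_left : _ ≤ coordSigma R (v ⁻¹' D) ⊔ coordSigma X S) le_rfl).sub
      (hsum t _ le_sup_right)
    convert h using 1
    ext ω
    exact (sub_sub_cancel _ _).symm
  have hind : Indep (coordSigma R Set.univ) (coordSigma X S) P := by
    have h := indepFun_mulVec hG hC (U := W)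
      (V := (1 : Matrix I I ℝ).submatrix (Subtype.val : S → I) id) (by
        ext t s
        simpa [Matrix.mul_apply (M := W * C), Matrix.one_apply] using hWC t s s.2)
    refine indep_of_indep_of_le_left (indep_of_indep_of_le_right h ?_) ?_
    · refine coordSigma_le_iff.2 fun s hs => measurable_iff_comap_le.2 ?_
      have : X s = (fun f : S → ℝ => f ⟨s, hs⟩) ∘ fun ω =>
          (1 : Matrix I I ℝ).submatrix (Subtype.val : S → I) id *ᵥ fun p => X p ω := by
        ext ω
        simp [mulVec, dotProduct, Matrix.one_apply]
      rw [this, ← MeasurableSpace.comap_comp]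
      exact MeasurableSpace.comap_mono (measurable_pi_apply _).comap_le
    · refine coordSigma_le_iff.2 fun t _ => measurable_iff_comap_le.2 ?_
      have : R t = (fun f : {p // p ∉ S} → ℝ => f t) ∘ fun ω => W *ᵥ fun p => X p ω := rfl
      rw [this, ← MeasurableSpace.comap_comp]
      exact MeasurableSpace.comap_mono (measurable_pi_apply _).comap_le
  have hres : CondIndep (coordSigma X S) (coordSigma X A) (coordSigma X B)
      (coordSigma_le hX S) P ↔ CondIndep (coordSigma X S) (coordSigma R (v ⁻¹' A))
      (coordSigma R (v ⁻¹' B)) (coordSigma_le hX S) P := by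
    constructor <;> intro h
    · have h' := CondIndep.sup_sup _ (coordSigma_le hX A) (coordSigma_le hX B) h
      exact condIndep_of_condIndep_of_le_left
        (condIndep_of_condIndep_of_le_right h' (hRX B)) (hRX A)
    · have h' := CondIndep.sup_sup _ (coordSigma_le hR _) (coordSigma_le hR _) h
      exact condIndep_of_condIndep_of_le_left
        (condIndep_of_condIndep_of_le_right h' (hXR B hBS)) (hXR A hAS)
  rw [hres, condIndep_iff_indep_of_indep _ (coordSigma_le hR _) (coordSigma_le hR _)
    (indep_of_indep_of_le_left hind (sup_le (coordSigma_mono (Set.subset_univ _))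
      (coordSigma_mono (Set.subset_univ _))))]
  have hQ : (C⁻¹.submatrix v v).PosDef := hCpd.inv.submatrix Subtype.val_injective
  have hnot : ∀ t : {p // p ∉ S}, t ∉ v ⁻¹' A ↔ t ∈ v ⁻¹' B := fun t =>
    ⟨fun h => ((hcover t).resolve_left h).resolve_right t.2,
      fun h => hAB.notMem_of_mem_right h⟩
  have hblock : (∀ a ∈ A, ∀ b ∈ B, C⁻¹ a b = 0) ↔
      ∀ a ∈ v ⁻¹' A, ∀ b ∉ v ⁻¹' A, C⁻¹.submatrix v v a b = 0 :=
    ⟨fun h a ha b hb => h a ha b ((hnot b).1 hb), fun h a ha b hb =>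
      h ⟨a, hAS.notMem_of_mem_left ha⟩ ha ⟨b, hBS.notMem_of_mem_left hb⟩ ((hnot _).2 hb)⟩
  have hinv : (∀ a ∈ A, ∀ b ∈ B, C⁻¹ a b = 0) ↔
      ∀ a ∈ v ⁻¹' A, ∀ b ∈ v ⁻¹' B, cov[R a, R b; P] = 0 := by
    simp only [hblock, hcov, ← hnot]
    refine ⟨Matrix.inv_apply_eq_zero_of_forall hQ.isUnit, fun h => ?_⟩
    have h' := Matrix.inv_apply_eq_zero_of_forall hQ.inv.isUnit h
    rwa [Matrix.nonsing_inv_nonsing_inv _ ((Matrix.isUnit_iff_isUnit_det _).1 hQ.isUnit)] at h'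
  rw [hinv]
  constructor
  · intro h a ha b hb
    have hab : IndepFun (R a) (R b) P :=
      indep_of_indep_of_le_left (indep_of_indep_of_le_right h
        (measurable_coordSigma hb).comap_le) (measurable_coordSigma ha).comap_le
    exact hab.covariance_eq_zero (hRLp a) (hRLp b)
  · intro h
    have hab := indepFun_mulVec hG hC
      (U := W.submatrix (Subtype.val : (v ⁻¹' A : Set _) → _) id)
      (V := W.submatrix (Subtype.val : (v ⁻¹' B : Set _) → _) id) (by
        ext a b
        rw [← covariance_mulVec hLp hC]
        exact h a a.2 b b.2)
    rw [coordSigma_eq_comap, coordSigma_eq_comap]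
    exact hab

end Gaussian

section Sequence

variable [MeasurableSpace Ω] {N d : ℕ} {x : ℕ → Ω → (Fin d → ℝ)}

lemma sigmaOf_eq_coordSigma {D : Set ℕ} (hD : ∀ k ∈ D, k ≤ N) :
    sigmaOf x D =
      coordSigma (fun p ω => stacked N x ω p) {p : Fin (N + 1) × Fin d | (p.1 : ℕ) ∈ D} := by
  refine le_antisymm (iSup₂_le fun k hk => measurable_iff_comap_le.1 ?_)
    (coordSigma_le_iff.2 fun p hp => ?_)
  · refine (@measurable_pi_iff _ _ _ (_) _ _).2 fun a => ?_
    let p : Fin (N + 1) × Fin d := (⟨k, Nat.lt_succ_of_le (hD k hk)⟩, a)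
    exact measurable_coordSigma (X := fun p ω => stacked N x ω p) (p := p) hk
  · have : Measurable[sigmaOf x D] (x p.1) :=
      measurable_iff_comap_le.2 (le_iSup₂_of_le (p.1 : ℕ) hp le_rfl)
    exact (measurable_pi_apply p.2).comp this

lemma IsGaussianVec.hasGaussianLaw {ι : Type*} [Fintype ι] {X : Ω → (ι → ℝ)} {P : Measure Ω}
    (h : IsGaussianVec X P) (hX : Measurable X) : HasGaussianLaw X P where
  isGaussian_map := by
    classical
    refine isGaussian_of_map_eq_gaussianReal fun L => ?_
    obtain ⟨m, v, hmv⟩ := h fun i => L (Pi.single i 1)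
    refine ⟨m, v, ?_⟩
    rw [Measure.map_map (by fun_prop) hX, ← hmv]
    congr 1
    ext ω
    rw [Function.comp_apply, ← L.coe_coe, LinearMap.pi_apply_eq_sum_univ]
    refine Finset.sum_congr rfl fun i _ => ?_
    rw [smul_eq_mul, mul_comm]
    congr 2
    ext j
    simp [Pi.single_apply, eq_comm]

end Sequence

/-- a nonsingular Gaussian sequence with covariance matrix `C` is `CM_L`
iff `C⁻¹` has the `CM_L` form: its `d × d` blocks `(C⁻¹)_{i,j}` vanish whenever
`|i − j| ≥ 2` and `N ∉ {i, j}`. -/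
theorem stmt_10 [MeasurableSpace Ω] [StandardBorelSpace Ω]
    (N d : ℕ) (hN : 2 ≤ N) (hd : 1 ≤ d)
    (P : Measure Ω) [IsProbabilityMeasure P]
    (x : ℕ → Ω → (Fin d → ℝ)) (hx : ∀ k, Measurable (x k))
    (hG : IsGaussianVec (stacked N x) P)
    (C : Matrix (Fin (N + 1) × Fin d) (Fin (N + 1) × Fin d) ℝ)
    (hC : ∀ p q, C p q = ∫ ω, (x p.1 ω p.2 - ∫ ω', x p.1 ω' p.2 ∂P) *
      (x q.1 ω q.2 - ∫ ω', x q.1 ω' q.2 ∂P) ∂P)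
    (hCpd : C.PosDef) :
    IsCM N N P x hx ↔
      ∀ i, ∀ hi : i ≤ N, ∀ j, ∀ hj : j ≤ N,
        (i + 2 ≤ j ∨ j + 2 ≤ i) → i ≠ N → j ≠ N →
        ∀ a b, C⁻¹ (⟨i, by omega⟩, a) (⟨j, by omega⟩, b) = 0 := by
  let X : Fin (N + 1) × Fin d → Ω → ℝ := fun p ω => stacked N x ω p
  have hX : ∀ p, Measurable (X p) := fun p => (measurable_pi_apply p.2).comp (hx p.1)
  have hXG : HasGaussianLaw (fun ω p => X p ω) P :=
    hG.hasGaussianLaw (measurable_pi_lambda _ hX)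
  have key : ∀ j ≤ N, CondIndep (sigmaOf x {j, N}) (sigmaOf x {k | j < k ∧ k ≤ N ∧ k ≠ N})
      (sigmaOf x {k | k < j ∧ k ≠ N}) (sigmaOf_le hx _) P ↔
      ∀ a : Fin (N + 1) × Fin d, (j < a.1 ∧ (a.1 : ℕ) ≤ N ∧ (a.1 : ℕ) ≠ N) →
        ∀ b : Fin (N + 1) × Fin d, ((b.1 : ℕ) < j ∧ (b.1 : ℕ) ≠ N) → C⁻¹ a b = 0 := by
    intro j hj
    have e₁ := sigmaOf_eq_coordSigma (x := x) (N := N) (D := {j, N})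
      (by rintro k (rfl | rfl) <;> omega)
    have e₂ := sigmaOf_eq_coordSigma (x := x) (N := N) (D := {k | j < k ∧ k ≤ N ∧ k ≠ N})
      fun k hk => hk.2.1
    have e₃ := sigmaOf_eq_coordSigma (x := x) (N := N) (D := {k | k < j ∧ k ≠ N})
      fun k hk => hk.1.le.trans hj
    simp only [e₁, e₂, e₃]
    refine condIndep_coordSigma_iff hX hXG hC hCpd (fun p => ?_) ?_ ?_ ?_
    · have := p.1.is_le
      simp only [Set.mem_ofPred_eq, Set.mem_insert_iff, Set.mem_singleton_iff]
      omega
    all_goals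
      refine Set.disjoint_left.2 fun p hp hp' => ?_
      simp only [Set.mem_ofPred_eq, Set.mem_insert_iff, Set.mem_singleton_iff] at hp hp'
      omega
  have hsymm : ∀ p q, C⁻¹ p q = C⁻¹ q p := fun p q => by
    simpa using (hCpd.inv.isHermitian.apply p q).symm
  constructor
  · intro h i hi j hj hij hiN hjN a b
    rcases hij with hij | hij
    · rw [hsymm]
      exact (key (i + 1) (by omega)).1 (h _ (by omega)) _ ⟨by simp; omega, by simp; omega, hjN⟩ _
        ⟨by simp, hiN⟩
    · exact (key (j + 1) (by omega)).1 (h _ (by omega)) _ ⟨by simp; omega, by simp; omega, hiN⟩ _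
        ⟨by simp, hjN⟩
  · intro h j hj
    refine (key j hj).2 fun a ha b hb => ?_
    exact h a.1 ha.2.1 b.1 (hb.1.le.trans hj) (by omega) ha.2.2 hb.2 a.2 b.2
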